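/- arXiv:2103.06699 — 4 statements merged into one kernel-verified Lean document; each statement's English description precedes it below -/
import Mathlib

section
/- The function Λ is even, 2π-periodic, strictly decreasing on the interval (0,π) and strictly increasing on the interval (−π,0). -/
open Real

noncomputable section

/-- `C` is the asymmetric cosine of the pair `(a, b)` for the resonance integer `n`:
the even, `2π/n`-periodic function equal to `cos(√a t)` on `[0, π/(2√a)]` and to
`−√(a/b)·sin(√b(t − π/(2√a)))` on `[π/(2√a), π/n]`. -/
def IsAsymCos (n : ℕ) (a b : ℝ) (C : ℝ → ℝ) : Prop :=
  (∀ t, C (-t) = C t) ∧ (∀ t, C (t + 2 * π / n) = C t) ∧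
  (∀ t ∈ Set.Icc (0 : ℝ) (π / (2 * Real.sqrt a)), C t = Real.cos (Real.sqrt a * t)) ∧
  (∀ t ∈ Set.Icc (π / (2 * Real.sqrt a)) (π / n),
      C t = - Real.sqrt (a / b) * Real.sin (Real.sqrt b * (t - π / (2 * Real.sqrt a))))

theorem aux_anti (n : ℕ) (hn : 1 ≤ n) (a b : ℝ)
    (ha : (n : ℝ) ^ 2 / 4 < a) (hb : 0 < b)
    (hres : 1 / Real.sqrt a + 1 / Real.sqrt b = 2 / (n : ℝ))
    (C : ℝ → ℝ) (hC : IsAsymCos n a b C) : StrictAntiOn C (Set.Icc 0 (π / n)) := by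
  obtain ⟨-, -, h1, h2⟩ := hC
  have hn0 : (0 : ℝ) < n := by exact_mod_cast hn
  have ha0 : 0 < a := lt_of_le_of_lt (by positivity) ha
  have hsa : 0 < Real.sqrt a := Real.sqrt_pos.2 ha0
  have hsb : 0 < Real.sqrt b := Real.sqrt_pos.2 hb
  have hpi := Real.pi_pos
  have hsum : π / n = π / (2 * Real.sqrt a) + π / (2 * Real.sqrt b) := by
    have : π / n = π / 2 * (2 / n) := by field_simp
    rw [this, ← hres]
    field_simp
  set m := π / (2 * Real.sqrt a) with hm
  have hm0 : 0 < m := by positivity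
  have hmb : 0 < π / (2 * Real.sqrt b) := by positivity
  have hma : Real.sqrt a * m = π / 2 := by rw [hm]; field_simp
  have hbb : Real.sqrt b * (π / n - m) = π / 2 := by rw [hsum]; field_simp; ring
  have A : StrictAntiOn C (Set.Icc 0 m) := by
    intro x hx y hy hxy
    rw [h1 x hx, h1 y hy]
    apply Real.strictAntiOn_cos
    · exact ⟨mul_nonneg hsa.le hx.1, by nlinarith [mul_le_mul_of_nonneg_left hx.2 hsa.le]⟩
    · exact ⟨mul_nonneg hsa.le hy.1, by nlinarith [mul_le_mul_of_nonneg_left hy.2 hsa.le]⟩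
    · exact mul_lt_mul_of_pos_left hxy hsa
  have B : StrictAntiOn C (Set.Icc m (π / n)) := by
    intro x hx y hy hxy
    rw [h2 x hx, h2 y hy]
    have hq : 0 < Real.sqrt (a / b) := Real.sqrt_pos.2 (by positivity)
    have key : ∀ z ∈ Set.Icc m (π / n), Real.sqrt b * (z - m) ∈ Set.Icc (-(π / 2)) (π / 2) := by
      intro z hz
      have h3 : 0 ≤ Real.sqrt b * (z - m) := mul_nonneg hsb.le (by linarith [hz.1])
      refine ⟨by linarith, ?_⟩
      rw [← hbb]
      exact mul_le_mul_of_nonneg_left (by linarith [hz.2]) hsb.le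
    have := Real.strictMonoOn_sin (key x hx) (key y hy)
      (mul_lt_mul_of_pos_left (by linarith) hsb)
    nlinarith [mul_lt_mul_of_pos_left this hq]
  have := A.union B (c := m) (isGreatest_Icc hm0.le) (isLeast_Icc (by linarith))
  rwa [Set.Icc_union_Icc_eq_Icc hm0.le (by linarith)] at this

theorem stmt0 (n : ℕ) (hn : 1 ≤ n) (a b a' : ℝ)
    (ha : (n : ℝ) ^ 2 / 4 < a) (hb : 0 < b)
    (hres : 1 / Real.sqrt a + 1 / Real.sqrt b = 2 / (n : ℝ))
    (ha' : (n : ℝ) ^ 2 / 4 < a')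
    (C : ℝ → ℝ) (hC : IsAsymCos n a b C)
    (K : ℝ → ℝ) (hK : ∀ t, K t = ∫ s in (0 : ℝ)..t, C s)
    (Λ : ℝ → ℝ)
    (hΛ : ∀ t, Λ t = K (t / n + π / (2 * Real.sqrt a')) - K (t / n - π / (2 * Real.sqrt a'))) :
    (∀ t, Λ (-t) = Λ t) ∧ (∀ t, Λ (t + 2 * π) = Λ t) ∧
    StrictAntiOn Λ (Set.Ioo 0 π) ∧ StrictMonoOn Λ (Set.Ioo (-π) 0) := by
  have hanti := aux_anti n hn a b ha hb hres C hC
  obtain ⟨heven, hper, -, -⟩ := hC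
  have hn0 : (0 : ℝ) < n := by exact_mod_cast hn
  have hpi := Real.pi_pos
  have hP : 0 < π / n := by positivity
  have ha0 : 0 < a' := lt_of_le_of_lt (by positivity) ha'
  have hsa : 0 < Real.sqrt a' := Real.sqrt_pos.2 ha0
  have hsn : (n : ℝ) / 2 < Real.sqrt a' := Real.lt_sqrt_of_sq_lt (by nlinarith)
  have hh0 : 0 < π / (2 * Real.sqrt a') := by positivity
  have hhP : π / (2 * Real.sqrt a') < π / n :=
    div_lt_div_of_pos_left hpi hn0 (by linarith)
  set h := π / (2 * Real.sqrt a') with hh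
  set P := π / n with hPdef
  have hTP : 2 * π / n = 2 * P := by rw [hPdef]; ring
  rw [hTP] at hper
  -- integrability
  have hI1 : IntervalIntegrable C MeasureTheory.volume 0 P := by
    apply AntitoneOn.intervalIntegrable
    rw [Set.uIcc_of_le hP.le]
    exact hanti.antitoneOn
  have hI2 : IntervalIntegrable C MeasureTheory.volume (-P) 0 := by
    apply MonotoneOn.intervalIntegrable
    rw [Set.uIcc_of_le (by linarith)]
    intro x hx y hy hxy
    rw [← heven x, ← heven y]
    exact hanti.antitoneOn ⟨by linarith [hy.2], by linarith [hy.1]⟩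
      ⟨by linarith [hx.2], by linarith [hx.1]⟩ (by linarith)
  have hI : ∀ x y, IntervalIntegrable C MeasureTheory.volume x y := by
    intro x y
    have hp : Function.Periodic C (2 * P) := hper
    refine hp.intervalIntegrable (t := -P) (by linarith) ?_ x y
    have : -P + 2 * P = P := by ring
    rw [this]
    exact hI2.trans hI1
  have hKsub : ∀ x y, K x - K y = ∫ s in y..x, C s := by
    intro x y
    rw [hK, hK, intervalIntegral.integral_interval_sub_left (hI _ _) (hI _ _)]
  have hKodd : ∀ x, K (-x) = - K x := by
    intro x
    rw [hK, hK]
    have := intervalIntegral.integral_comp_neg (a := 0) (b := x) C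
    simp only [heven, neg_zero] at this
    rw [this, intervalIntegral.integral_symm]
  have hE : ∀ t, Λ (-t) = Λ t := by
    intro t
    rw [hΛ, hΛ]
    have e1 : -t / n + h = -(t / n - h) := by ring
    have e2 : -t / n - h = -(t / n + h) := by ring
    rw [e1, e2, hKodd, hKodd]; ring
  have hA : StrictAntiOn Λ (Set.Ioo 0 π) := by
    intro x hx y hy hxy
    have hlt : x / n < y / n := div_lt_div_of_pos_right hxy hn0
    have hx0 : 0 < x / n := div_pos hx.1 hn0
    have hyP : y / n < P := div_lt_div_of_pos_right hy.2 hn0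
    have hi1 : IntervalIntegrable (fun u => C (u - h)) MeasureTheory.volume (x / n) (y / n) := by
      have := (hI (x / n - h) (y / n - h)).comp_sub_right h
      simpa using this
    have hi2 : IntervalIntegrable (fun u => C (u + h)) MeasureTheory.volume (x / n) (y / n) := by
      have := (hI (x / n + h) (y / n + h)).comp_add_right h
      simpa using this
    have hpos : 0 < ∫ u in (x / n)..(y / n), (C (u - h) - C (u + h)) := by
      apply intervalIntegral.intervalIntegral_pos_of_pos_on (hi1.sub hi2) _ hlt
      intro u hu
      have hu0 : 0 < u := hx0.trans hu.1
      have huP : u < P := hu.2.trans hyP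
      have habs : C (u - h) = C |u - h| := by
        rcases abs_choice (u - h) with hc | hc <;> rw [hc]
        rw [heven]
      rw [sub_pos, habs]
      rcases le_total (u + h) P with hc | hc
      · have : |u - h| < u + h := abs_lt.2 ⟨by linarith, by linarith⟩
        exact hanti ⟨abs_nonneg _, by linarith⟩ ⟨by linarith, hc⟩ this
      · have e : C (u + h) = C (2 * P - u - h) := by
          rw [← heven, ← hper]; congr 1; ring
        rw [e]
        have : |u - h| < 2 * P - u - h := abs_lt.2 ⟨by linarith, by linarith⟩
        exact hanti ⟨abs_nonneg _, by linarith⟩ ⟨by linarith, by linarith⟩ this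
    rw [intervalIntegral.integral_sub hi1 hi2, intervalIntegral.integral_comp_sub_right C,
      intervalIntegral.integral_comp_add_right C, ← hKsub, ← hKsub] at hpos
    rw [hΛ, hΛ]
    linarith
  refine ⟨hE, ?_, hA, ?_⟩
  · intro t
    rw [hΛ, hΛ, hKsub, hKsub]
    have e1 : (t + 2 * π) / n + h = t / n + h + 2 * P := by rw [hPdef]; ring
    have e2 : (t + 2 * π) / n - h = t / n - h + 2 * P := by rw [hPdef]; ring
    rw [e1, e2, ← intervalIntegral.integral_comp_add_right C]
    simp only [hper]
  · intro x hx y hy hxy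
    rw [← hE x, ← hE y]
    exact hA ⟨by linarith [hy.2], by linarith [hy.1]⟩
      ⟨by linarith [hx.2], by linarith [hx.1]⟩ (by linarith)
end
end

section
/- The resolubility set R contains the two half-lines {(n², a₂) : a₂ > n²/4} and {(a₁, n²) : a₁ > n²/4}; that is, Λ_{a₁,a₂}(π) < α(a₁) < Λ_{a₁,a₂}(0) holds whenever a₁ = n² and a₂ > n²/4, and also whenever a₂ = n² and a₁ > n²/4. -/
open Real

noncomputable section

/-- Data extracted from the definition of the asymmetric cosine, with `r = √a`, `u = √b`. -/
lemma asym_core (B A r u : ℝ) (hr : 0 < r) (hu : 0 < u) (hA : A = π / (2 * r)) (hAB : A ≤ B)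
    (C : ℝ → ℝ) (hev : ∀ t, C (-t) = C t) (hper : ∀ t, C (t + 2 * B) = C t)
    (h1 : ∀ t ∈ Set.Icc (0 : ℝ) A, C t = Real.cos (r * t))
    (h2 : ∀ t ∈ Set.Icc A B, C t = - (r / u) * Real.sin (u * (t - A)))
    (K : ℝ → ℝ) (hK : ∀ t, K t = ∫ s in (0 : ℝ)..t, C s) :
    (∀ t ∈ Set.Icc (0 : ℝ) A, K t = Real.sin (r * t) / r) ∧
    (∀ t ∈ Set.Icc A B, K t = 1 / r - r / u ^ 2 * (1 - Real.cos (u * (t - A)))) ∧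
    (∀ t, K (-t) = - K t) ∧
    (∀ t ∈ Set.Icc (0 : ℝ) B, K (B + t) = 2 * K B - K (B - t)) := by
  have hA0 : 0 < A := by rw [hA]; positivity
  have int1 : ∀ t ∈ Set.Icc (0 : ℝ) A, IntervalIntegrable C MeasureTheory.volume 0 t := by
    intro t ht
    have : IntervalIntegrable (fun s => Real.cos (r * s)) MeasureTheory.volume 0 t :=
      Continuous.intervalIntegrable (by fun_prop) _ _
    refine this.congr ?_
    intro s hs
    rw [Set.uIoc_of_le ht.1] at hs
    exact (h1 s ⟨hs.1.le, hs.2.trans ht.2⟩).symm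
  have int2 : ∀ t ∈ Set.Icc A B, IntervalIntegrable C MeasureTheory.volume A t := by
    intro t ht
    have : IntervalIntegrable (fun s => - (r / u) * Real.sin (u * (s - A)))
        MeasureTheory.volume A t :=
      Continuous.intervalIntegrable (by fun_prop) _ _
    refine this.congr ?_
    intro s hs
    rw [Set.uIoc_of_le ht.1] at hs
    exact (h2 s ⟨hs.1.le, hs.2.trans ht.2⟩).symm
  have K1 : ∀ t ∈ Set.Icc (0 : ℝ) A, K t = Real.sin (r * t) / r := by
    intro t ht
    have e : ∫ s in (0 : ℝ)..t, C s = ∫ s in (0 : ℝ)..t, Real.cos (r * s) := by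
      apply intervalIntegral.integral_congr
      intro s hs
      rw [Set.uIcc_of_le ht.1] at hs
      exact h1 s ⟨hs.1, hs.2.trans ht.2⟩
    have e2 : ∫ s in (0 : ℝ)..t, Real.cos (r * s) = Real.sin (r * t) / r - Real.sin (r * 0) / r := by
      apply intervalIntegral.integral_eq_sub_of_hasDerivAt (f := fun s => Real.sin (r * s) / r)
      · intro x _
        have := (((hasDerivAt_id x).const_mul r).sin).div_const r
        refine HasDerivAt.congr_deriv this ?_
        simp only [id]
        field_simp
      · exact Continuous.intervalIntegrable (by fun_prop) _ _
    rw [hK, e, e2]; simp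
  have K2 : ∀ t ∈ Set.Icc A B, K t = 1 / r - r / u ^ 2 * (1 - Real.cos (u * (t - A))) := by
    intro t ht
    have e : ∫ s in A..t, C s = ∫ s in A..t, - (r / u) * Real.sin (u * (s - A)) := by
      apply intervalIntegral.integral_congr
      intro s hs
      rw [Set.uIcc_of_le ht.1] at hs
      exact h2 s ⟨hs.1, hs.2.trans ht.2⟩
    have e2 : ∫ s in A..t, - (r / u) * Real.sin (u * (s - A))
        = r / u ^ 2 * Real.cos (u * (t - A)) - r / u ^ 2 * Real.cos (u * (A - A)) := by
      apply intervalIntegral.integral_eq_sub_of_hasDerivAt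
        (f := fun s => r / u ^ 2 * Real.cos (u * (s - A)))
      · intro x _
        have := ((((hasDerivAt_id x).sub_const A).const_mul u).cos).const_mul (r / u ^ 2)
        refine HasDerivAt.congr_deriv this ?_
        simp only [id]
        field_simp
      · exact Continuous.intervalIntegrable (by fun_prop) _ _
    have hKA := K1 A ⟨hA0.le, le_rfl⟩
    have hrA : r * A = π / 2 := by rw [hA]; field_simp
    rw [hrA, Real.sin_pi_div_two, hK] at hKA
    rw [hK, ← intervalIntegral.integral_add_adjacent_intervals (int1 A ⟨hA0.le, le_rfl⟩) (int2 t ht),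
      hKA, e, e2]
    simp
    ring
  have int3 : IntervalIntegrable C MeasureTheory.volume 0 B :=
    (int1 A ⟨hA0.le, le_rfl⟩).trans (int2 B ⟨hAB, le_rfl⟩)
  refine ⟨K1, K2, ?_, ?_⟩
  · intro t
    have := intervalIntegral.integral_comp_neg (a := 0) (b := t) C
    simp only [hev, neg_zero] at this
    rw [hK, hK, this, intervalIntegral.integral_symm]
  · intro t ht
    have hB : 0 ≤ B := hA0.le.trans hAB
    have hsym : ∀ s, C (2 * B - s) = C s := by
      intro s
      rw [← hev s, ← hper (-s)]; congr 1; ring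
    have i1 : IntervalIntegrable C MeasureTheory.volume 0 (B - t) :=
      int3.mono_set (by
        rw [Set.uIcc_of_le hB, Set.uIcc_of_le (by linarith [ht.2])]
        exact Set.Icc_subset_Icc le_rfl (by linarith [ht.1]))
    have i2 : IntervalIntegrable C MeasureTheory.volume (B - t) B := i1.symm.trans int3
    have i3 : IntervalIntegrable C MeasureTheory.volume B (B + t) := by
      have := i2.comp_sub_left (2 * B)
      simp only [hsym] at this
      rw [show 2 * B - (B - t) = B + t by ring, show 2 * B - B = B by ring] at this
      exact this.symm
    have e := intervalIntegral.integral_comp_sub_left (a := B) (b := B + t) C (2 * B)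
    simp only [hsym] at e
    rw [show 2 * B - (B + t) = B - t by ring, show 2 * B - B = B by ring] at e
    have e3 := intervalIntegral.integral_add_adjacent_intervals i1 i2
    have e4 := intervalIntegral.integral_add_adjacent_intervals int3 i3
    rw [hK, hK, hK]
    linarith

/-- The resolubility set `R` contains the half-lines `{(n², a₂)}` and `{(a₁, n²)}`. -/
theorem stmt2 (n : ℕ) (hn : 1 ≤ n) (a₁ b₁ a₂ : ℝ)
    (ha₁ : (n : ℝ) ^ 2 / 4 < a₁) (hb₁ : 0 < b₁)
    (hres₁ : 1 / Real.sqrt a₁ + 1 / Real.sqrt b₁ = 2 / (n : ℝ))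
    (ha₂ : (n : ℝ) ^ 2 / 4 < a₂)
    (C₁ : ℝ → ℝ) (hC₁ : IsAsymCos n a₁ b₁ C₁)
    (K₁ : ℝ → ℝ) (hK₁ : ∀ t, K₁ t = ∫ s in (0 : ℝ)..t, C₁ s)
    (Λ : ℝ → ℝ)
    (hΛ : ∀ t, Λ t = K₁ (t / n + π / (2 * Real.sqrt a₂)) - K₁ (t / n - π / (2 * Real.sqrt a₂)))
    (α : ℝ) (hα : α = 1 / Real.sqrt a₁ - Real.sqrt a₁ / b₁)
    (hline : a₁ = (n : ℝ) ^ 2 ∨ a₂ = (n : ℝ) ^ 2) :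
    Λ π < α ∧ α < Λ 0 := by
  obtain ⟨hev, hper, h1, h2⟩ := hC₁
  have hn0 : (0 : ℝ) < n := by exact_mod_cast hn
  have hpi := Real.pi_pos
  have ha0 : 0 < a₁ := lt_of_le_of_lt (by positivity) ha₁
  have ha20 : 0 < a₂ := lt_of_le_of_lt (by positivity) ha₂
  rw [Real.sqrt_div ha0.le] at h2
  have hr : 0 < √a₁ := Real.sqrt_pos.2 ha0
  have hu : 0 < √b₁ := Real.sqrt_pos.2 hb₁
  have hv : 0 < √a₂ := Real.sqrt_pos.2 ha20
  have hub : √b₁ ^ 2 = b₁ := Real.sq_sqrt hb₁.le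
  have hline' : √a₁ = n ∨ √a₂ = n := by
    rcases hline with h | h
    · left; rw [h, Real.sqrt_sq hn0.le]
    · right; rw [h, Real.sqrt_sq hn0.le]
  have hvn : (n : ℝ) / 2 < √a₂ := by
    apply Real.lt_sqrt_of_sq_lt; linarith
  rw [← hub] at hα
  generalize √a₁ = r at *
  generalize √b₁ = u at *
  generalize √a₂ = v at *
  have hBval : π / n = π / (2 * r) + π / (2 * u) := by
    have : π / n = π / 2 * (2 / n) := by field_simp
    rw [this, ← hres₁]; field_simp
  obtain ⟨K1, K2, Kodd, Kref⟩ := asym_core (π / n) (π / (2 * r)) r u hr hu rfl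
    (by rw [hBval]; have : 0 < π / (2 * u) := by positivity
        linarith) C₁ hev
    (by intro t; rw [← hper t]; congr 2; ring) h1 h2 K₁ hK₁
  have hA0 : 0 < π / (2 * r) := by positivity
  have hE0 : 0 < π / (2 * u) := by positivity
  have hh0 : 0 < π / (2 * v) := by positivity
  have hhB : π / (2 * v) < π / n := by
    apply div_lt_div_of_pos_left hpi hn0; linarith
  have KB : K₁ (π / n) = α := by
    rw [K2 _ ⟨by linarith, le_rfl⟩, hα, hBval,
      show u * (π / (2 * r) + π / (2 * u) - π / (2 * r)) = π / 2 by field_simp; ring,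
      Real.cos_pi_div_two]
    field_simp
    ring
  have key : ∀ t, 0 < t → t < π / n → (r = n ∨ t = π / (2 * n)) → α < 2 * K₁ t := by
    intro t ht0 htB hc
    rcases hc with hc | hc
    · have hur : u = r := by
        have : 1 / u = 1 / r := by
          rw [← hc] at hres₁
          have : 2 / r = 1 / r + 1 / r := by ring
          linarith
        field_simp at this
        linarith
      subst hur
      have hα0 : α = 0 := by rw [hα]; field_simp; ring
      rw [hα0]
      rcases le_total t (π / (2 * u)) with h | h
      · rw [K1 t ⟨ht0.le, h⟩]
        have : 0 < Real.sin (u * t) := by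
          apply Real.sin_pos_of_pos_of_lt_pi (by positivity)
          have : u * t < u * (π / n) := by gcongr
          rw [← hc] at this
          have h3 : u * (π / u) = π := by field_simp
          linarith
        positivity
      · rw [K2 t ⟨h, htB.le⟩]
        have hlt : u * (t - π / (2 * u)) < u * (π / (2 * u)) := by
          apply mul_lt_mul_of_pos_left _ hu; linarith
        have e : u * (π / (2 * u)) = π / 2 := by field_simp
        have h0 : 0 ≤ u * (t - π / (2 * u)) := mul_nonneg hu.le (by linarith)
        have hcos := Real.cos_pos_of_mem_Ioo (x := u * (t - π / (2 * u)))
          ⟨by linarith, by linarith⟩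
        have : 1 / u - u / u ^ 2 * (1 - Real.cos (u * (t - π / (2 * u))))
          = Real.cos (u * (t - π / (2 * u))) / u := by field_simp; ring
        rw [this]; positivity
    · have ht : t = π / (4 * r) + π / (4 * u) := by
        have e : t = π / n / 2 := by rw [hc]; field_simp
        rw [e, hBval]; field_simp; ring
      have hs2 : (1 : ℝ) < √2 := by
        apply Real.lt_sqrt_of_sq_lt; norm_num
      rcases le_total r u with h | h
      · have hq : π / (4 * u) ≤ π / (4 * r) := by gcongr
        have hsplit : π / (2 * r) = π / (4 * r) + π / (4 * r) := by field_simp; ring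
        rw [K1 t ⟨ht0.le, by linarith⟩]
        have hsin : √2 / 2 ≤ Real.sin (r * t) := by
          rw [← Real.sin_pi_div_four]
          have e1 : r * (π / (4 * r)) = π / 4 := by field_simp
          have l1 : r * (π / (4 * r)) ≤ r * t := by
            apply mul_le_mul_of_nonneg_left _ hr.le
            have : 0 < π / (4 * u) := by positivity
            linarith
          have l2 : r * t ≤ r * (π / (4 * r) + π / (4 * r)) := by
            apply mul_le_mul_of_nonneg_left _ hr.le; linarith
          apply Real.sin_le_sin_of_le_of_le_pi_div_two <;> linarith
        have h3 : 1 / r < 2 * (Real.sin (r * t) / r) := by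
          rw [← mul_div_assoc]; gcongr; linarith
        have h4 : 0 < r / u ^ 2 := by positivity
        linarith
      · have hq : π / (4 * r) ≤ π / (4 * u) := by gcongr
        have hsplit : π / (2 * r) = π / (4 * r) + π / (4 * r) := by field_simp; ring
        rw [K2 t ⟨by linarith, htB.le⟩]
        have hcos : √2 / 2 ≤ Real.cos (u * (t - π / (2 * r))) := by
          rw [← Real.cos_pi_div_four]
          have e1 : u * (π / (4 * u)) = π / 4 := by field_simp
          have l1 : u * (t - π / (2 * r)) ≤ u * (π / (4 * u)) := by
            apply mul_le_mul_of_nonneg_left _ hu.le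
            have : 0 < π / (4 * r) := by positivity
            linarith
          have l2 : 0 ≤ u * (t - π / (2 * r)) := mul_nonneg hu.le (by linarith)
          apply Real.cos_le_cos_of_nonneg_of_le_pi <;> linarith
        have h4 : 0 < r / u ^ 2 := by positivity
        have h5 : 0 < 1 / r := by positivity
        have h6 : 0 < r / u ^ 2 * (2 * Real.cos (u * (t - π / (2 * r))) - 1) :=
          mul_pos h4 (by linarith)
        rw [hα]
        linarith
  have hhalf : π / (2 * (n : ℝ)) = π / n - π / (2 * n) := by field_simp; ring
  constructor
  · rw [hΛ, Kref _ ⟨hh0.le, hhB.le⟩, KB]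
    have := key (π / n - π / (2 * v)) (by linarith) (by linarith) (by
      rcases hline' with h | h
      · exact Or.inl h
      · right; rw [h]; exact hhalf.symm)
    linarith
  · rw [hΛ, zero_div, zero_add, zero_sub, Kodd]
    have := key (π / (2 * v)) hh0 hhB (by
      rcases hline' with h | h
      · exact Or.inl h
      · right; rw [h])
    linarith
end
end

section
/- For every θ₁, θ₂ ∈ ℝ, the integral of C₁(θ₁/n + t) over the set J⁺ = {t ∈ [0,2π] : C₂(θ₂/n + t) > 0} equals n·Λ₁(θ₁ − θ₂), i.e. ∫_{J⁺} C₁(θ₁/n + t) dt = n Λ₁(θ₁ − θ₂). -/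
open Real MeasureTheory

noncomputable section

/-- Elementary facts about the quarter period `q = π / (2 √a)`. -/
lemma asym_q (n : ℕ) (hn : 1 ≤ n) (a b : ℝ) (ha : (n : ℝ) ^ 2 / 4 < a) (hb : 0 < b)
    (hres : 1 / Real.sqrt a + 1 / Real.sqrt b = 2 / (n : ℝ)) :
    0 < Real.sqrt a ∧ 0 < Real.sqrt b ∧ 0 < π / (2 * Real.sqrt a) ∧
      π / (2 * Real.sqrt a) < π / n ∧ Real.sqrt b * (π / n - π / (2 * Real.sqrt a)) = π / 2 := by
  have hn0 : (0 : ℝ) < n := by exact_mod_cast hn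
  have ha0 : 0 < a := lt_trans (by positivity) ha
  have hsa : 0 < Real.sqrt a := Real.sqrt_pos.2 ha0
  have hsb : 0 < Real.sqrt b := Real.sqrt_pos.2 hb
  have hpi := Real.pi_pos
  have key : π / n - π / (2 * Real.sqrt a) = π / (2 * Real.sqrt b) := by
    have h1 : π / n = π / 2 * (2 / n) := by ring
    rw [h1, ← hres]
    field_simp
    ring
  refine ⟨hsa, hsb, by positivity, ?_, ?_⟩
  · have : 0 < π / (2 * Real.sqrt b) := by positivity
    linarith
  · rw [key]; field_simp

lemma asym_integrable (n : ℕ) (hn : 1 ≤ n) (a b : ℝ) (ha : (n : ℝ) ^ 2 / 4 < a) (hb : 0 < b)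
    (hres : 1 / Real.sqrt a + 1 / Real.sqrt b = 2 / (n : ℝ))
    (C : ℝ → ℝ) (hC : IsAsymCos n a b C) (x y : ℝ) : IntervalIntegrable C volume x y := by
  obtain ⟨hsa, hsb, hq, hqh, -⟩ := asym_q n hn a b ha hb hres
  obtain ⟨heven, hper, h1, h2⟩ := hC
  have hn0 : (0 : ℝ) < n := by exact_mod_cast hn
  have hpi := Real.pi_pos
  have i1 : IntervalIntegrable C volume 0 (π / (2 * Real.sqrt a)) := by
    apply ContinuousOn.intervalIntegrable_of_Icc hq.le
    refine ContinuousOn.congr (f := fun t => Real.cos (Real.sqrt a * t)) ?_ h1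
    fun_prop
  have i2 : IntervalIntegrable C volume (π / (2 * Real.sqrt a)) (π / n) := by
    apply ContinuousOn.intervalIntegrable_of_Icc hqh.le
    refine ContinuousOn.congr (f := fun t => - Real.sqrt (a / b) *
      Real.sin (Real.sqrt b * (t - π / (2 * Real.sqrt a)))) ?_ h2
    fun_prop
  have i3 := i1.trans i2
  have i4 : IntervalIntegrable C volume (-(π / n)) 0 := by
    have := (IntervalIntegrable.iff_comp_neg (f := C)).1 i3
    simp only [heven, neg_zero] at this
    exact this.symm
  have hp : Function.Periodic C (2 * π / n) := hper
  refine hp.intervalIntegrable (by positivity) (t := -(π / n)) ?_ x y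
  have e : -(π / n) + 2 * π / n = π / n := by ring
  rw [e]
  exact i4.trans i3

lemma asym_pos_iff (n : ℕ) (hn : 1 ≤ n) (a b : ℝ) (ha : (n : ℝ) ^ 2 / 4 < a) (hb : 0 < b)
    (hres : 1 / Real.sqrt a + 1 / Real.sqrt b = 2 / (n : ℝ))
    (C : ℝ → ℝ) (hC : IsAsymCos n a b C) (u : ℝ) (hu : |u| ≤ π / n) :
    0 < C u ↔ |u| < π / (2 * Real.sqrt a) := by
  obtain ⟨hsa, hsb, hq, hqh, hbq⟩ := asym_q n hn a b ha hb hres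
  obtain ⟨heven, hper, h1, h2⟩ := hC
  have hpi := Real.pi_pos
  have habs : C u = C |u| := by
    rcases abs_choice u with h | h <;> rw [h]
    rw [heven]
  rw [habs]
  have h0 := abs_nonneg u
  generalize |u| = v at *
  constructor
  · intro h
    by_contra! hv
    rw [h2 v ⟨hv, hu⟩] at h
    have : 0 ≤ Real.sin (Real.sqrt b * (v - π / (2 * Real.sqrt a))) := by
      apply Real.sin_nonneg_of_nonneg_of_le_pi
      · exact mul_nonneg hsb.le (by linarith)
      · have : Real.sqrt b * (v - π / (2 * Real.sqrt a)) ≤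
          Real.sqrt b * (π / n - π / (2 * Real.sqrt a)) := by gcongr
        linarith
    have h3 := mul_nonneg (Real.sqrt_nonneg (a / b)) this
    linarith
  · intro hv
    rw [h1 v ⟨h0, hv.le⟩]
    apply Real.cos_pos_of_mem_Ioo
    have h4 := mul_nonneg hsa.le h0
    have h5 : Real.sqrt a * v < Real.sqrt a * (π / (2 * Real.sqrt a)) := by gcongr
    have h6 : Real.sqrt a * (π / (2 * Real.sqrt a)) = π / 2 := by field_simp
    constructor <;> linarith

lemma asym_meas (n : ℕ) (hn : 1 ≤ n) (a b : ℝ) (ha : (n : ℝ) ^ 2 / 4 < a) (hb : 0 < b)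
    (hres : 1 / Real.sqrt a + 1 / Real.sqrt b = 2 / (n : ℝ))
    (C : ℝ → ℝ) (hC : IsAsymCos n a b C) : MeasurableSet {u : ℝ | 0 < C u} := by
  obtain ⟨hsa, hsb, hq, hqh, hbq⟩ := asym_q n hn a b ha hb hres
  have hn0 : (0 : ℝ) < n := by exact_mod_cast hn
  have hpi := Real.pi_pos
  have hper : Function.Periodic C (2 * π / n) := hC.2.1
  have : {u : ℝ | 0 < C u} =
      ⋃ k : ℤ, {u : ℝ | |u - k * (2 * π / n)| < π / (2 * Real.sqrt a)} := by
    ext u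
    simp only [Set.mem_setOf_eq, Set.mem_iUnion]
    constructor
    · intro h
      refine ⟨round (u / (2 * π / n)), ?_⟩
      rw [← asym_pos_iff n hn a b ha hb hres C hC, hper.sub_int_mul_eq]
      · exact h
      · have hp : 0 < 2 * π / n := by positivity
        have h1 := abs_sub_round (u / (2 * π / n))
        have h2 : u - round (u / (2 * π / n)) * (2 * π / n) =
          (u / (2 * π / n) - round (u / (2 * π / n))) * (2 * π / n) := by
          rw [sub_mul, div_mul_cancel₀ _ hp.ne']
        rw [h2, abs_mul, abs_of_pos hp]
        calc _ ≤ 1 / 2 * (2 * π / n) := by gcongr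
          _ = π / n := by ring
    · rintro ⟨k, hk⟩
      rw [← asym_pos_iff n hn a b ha hb hres C hC _ (hk.le.trans hqh.le),
        hper.sub_int_mul_eq] at hk
      exact hk
  rw [this]
  refine MeasurableSet.iUnion fun k => ?_
  apply IsOpen.measurableSet
  exact isOpen_lt (by fun_prop) (by fun_prop)

theorem stmt6 (n : ℕ) (hn : 1 ≤ n) (a₁ b₁ a₂ b₂ : ℝ)
    (ha₁ : (n : ℝ) ^ 2 / 4 < a₁) (hb₁ : 0 < b₁)
    (hres₁ : 1 / Real.sqrt a₁ + 1 / Real.sqrt b₁ = 2 / (n : ℝ))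
    (ha₂ : (n : ℝ) ^ 2 / 4 < a₂) (hb₂ : 0 < b₂)
    (hres₂ : 1 / Real.sqrt a₂ + 1 / Real.sqrt b₂ = 2 / (n : ℝ))
    (C₁ C₂ : ℝ → ℝ) (hC₁ : IsAsymCos n a₁ b₁ C₁) (hC₂ : IsAsymCos n a₂ b₂ C₂)
    (K₁ : ℝ → ℝ) (hK₁ : ∀ t, K₁ t = ∫ s in (0 : ℝ)..t, C₁ s)
    (Λ₁ : ℝ → ℝ)
    (hΛ₁ : ∀ t, Λ₁ t = K₁ (t / n + π / (2 * Real.sqrt a₂)) - K₁ (t / n - π / (2 * Real.sqrt a₂))) :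
    ∀ θ₁ θ₂ : ℝ,
      ∫ t in {t : ℝ | t ∈ Set.Icc (0 : ℝ) (2 * π) ∧ 0 < C₂ (θ₂ / n + t)}, C₁ (θ₁ / n + t) =
        n * Λ₁ (θ₁ - θ₂) := by
  intro θ₁ θ₂
  obtain ⟨hsa, hsb, hq, hqh, hbq⟩ := asym_q n hn a₂ b₂ ha₂ hb₂ hres₂
  have hint := asym_integrable n hn a₁ b₁ ha₁ hb₁ hres₁ C₁ hC₁
  have hpos := asym_pos_iff n hn a₂ b₂ ha₂ hb₂ hres₂ C₂ hC₂
  have hmeas := asym_meas n hn a₂ b₂ ha₂ hb₂ hres₂ C₂ hC₂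
  have hn0 : (0 : ℝ) < n := by exact_mod_cast hn
  have hpi := Real.pi_pos
  have hper₁ : Function.Periodic C₁ (2 * π / n) := hC₁.2.1
  have hper₂ : Function.Periodic C₂ (2 * π / n) := hC₂.2.1
  rw [hΛ₁, hK₁, hK₁, intervalIntegral.integral_interval_sub_left (hint _ _) (hint _ _)]
  generalize hqdef : π / (2 * Real.sqrt a₂) = q at *
  set d : ℝ := (θ₁ - θ₂) / n with hd
  set P : Set ℝ := {u : ℝ | 0 < C₂ u} with hP
  set G : ℝ → ℝ := P.indicator (fun u => C₁ (d + u)) with hG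
  have hGper : Function.Periodic G (2 * π / n) := by
    intro u
    have e : u + 2 * π / n ∈ P ↔ u ∈ P := by simp only [hP, Set.mem_setOf_eq, hper₂ u]
    simp only [hG, Set.indicator, e, ← add_assoc, hper₁ (d + u)]
  have hGint : ∀ x y, IntervalIntegrable G volume x y := by
    intro x y
    have h1 : IntervalIntegrable (fun u => C₁ (d + u)) volume x y := by
      have := (hint (x + d) (y + d)).comp_add_left d
      simpa using this
    exact ⟨h1.1.indicator hmeas, h1.2.indicator hmeas⟩
  have hset : {t : ℝ | t ∈ Set.Icc (0 : ℝ) (2 * π) ∧ 0 < C₂ (θ₂ / n + t)} =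
      Set.Icc (0 : ℝ) (2 * π) ∩ (fun t => θ₂ / n + t) ⁻¹' P := rfl
  have hm' : MeasurableSet ((fun t => θ₂ / n + t) ⁻¹' P) := hmeas.preimage (by fun_prop)
  rw [hset, ← setIntegral_indicator hm']
  have hfun : ((fun t => θ₂ / n + t) ⁻¹' P).indicator (fun t => C₁ (θ₁ / n + t)) =
      fun t => G (θ₂ / n + t) := by
    ext t
    simp only [hG, Set.indicator, Set.mem_preimage]
    have : d + (θ₂ / n + t) = θ₁ / n + t := by rw [hd]; ring
    rw [this]
  rw [hfun, integral_Icc_eq_integral_Ioc, ← intervalIntegral.integral_of_le (by positivity),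
    intervalIntegral.integral_comp_add_left, add_zero]
  have h2pi : 2 * π = (n : ℤ) • (2 * π / n) := by
    simp only [zsmul_eq_mul, Int.cast_natCast]; field_simp
  have hbig : ∫ x in (θ₂ / n)..(θ₂ / n + 2 * π), G x =
      n * ∫ x in (-(π / n))..(π / n), G x := by
    conv_lhs => rw [h2pi]
    rw [hGper.intervalIntegral_add_zsmul_eq _ _ hGint,
      hGper.intervalIntegral_add_eq _ (-(π / n))]
    have e : -(π / n) + 2 * π / n = π / n := by ring
    rw [e]; simp
  rw [hbig]
  congr 1
  have hle : -(π / n) ≤ π / n := by have : 0 < π / n := by positivity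
                                    linarith
  rw [intervalIntegral.integral_of_le hle, hG, setIntegral_indicator hmeas]
  have hI : Set.Ioc (-(π / n)) (π / n) ∩ P = Set.Ioo (-q) q := by
    ext u
    simp only [hP, Set.mem_inter_iff, Set.mem_Ioc, Set.mem_setOf_eq, Set.mem_Ioo]
    constructor
    · rintro ⟨⟨h1, h2⟩, h3⟩
      exact abs_lt.1 ((hpos u (abs_le.2 ⟨h1.le, h2⟩)).1 h3)
    · rintro ⟨h1, h2⟩
      refine ⟨⟨by linarith, by linarith⟩, ?_⟩
      exact (hpos u (abs_le.2 ⟨by linarith, by linarith⟩)).2 (abs_lt.2 ⟨h1, h2⟩)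
  rw [hI, ← integral_Ioc_eq_integral_Ioo, ← intervalIntegral.integral_of_le (by linarith),
    intervalIntegral.integral_comp_add_left, ← sub_eq_add_neg]
end
end

section
/- Let L : ℝ² → ℝ² be C¹ and 2π-periodic in each variable, and let F = (F₁,F₂), G = (G₁,G₂) : ℝ² × (0,∞)² → ℝ² be continuous, 2π-periodic in each angular variable, and such that for every δ > 0 there exists M > 0 with ‖F(θ,r)‖ ≤ δ and ‖G(θ,r)‖ ≤ δ whenever min(r₁,r₂) ≥ M (uniformly in θ ∈ ℝ²). Suppose there exists ω ∈ ℝ² with L(ω) = 0 and such that the Jacobian matrix JL(ω) is a D⁺-matrix. Then there exist R > 0, Θ ∈ (0,π), λ > 0 and η ∈ (0,λ) such that: whenever (θ,r) ∈ ℝ² × (0,∞)² satisfies r₁ ≥ R, r₂ ≥ R, λ − η ≤ r₁/r₂ ≤ λ + η and d_T(θ,ω) ≤ Θ, the image point (u,ρ) defined by u_i = θ_i + (L_i(θ) + G_i(θ,r))/r_i and ρ_i = r_i − ∂L_i/∂θ_i(θ) + F_i(θ,r) (for i = 1,2) satisfies ρ₁ ≥ R, ρ₂ ≥ R, λ − η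 ≤ ρ₁/ρ₂ ≤ λ + η and d_T(u,ω) ≤ Θ. -/
open Real

noncomputable section

/-- Euclidean norm of a point of `ℝ²` (written as a pair). -/
def enorm2 (v : ℝ × ℝ) : ℝ := Real.sqrt (v.1 ^ 2 + v.2 ^ 2)

/-- The torus distance between two points of `ℝ²` (identified modulo `2π` in each variable). -/
def torusDist (θ ω : ℝ × ℝ) : ℝ :=
  Real.sqrt ((⨅ k : ℤ, |θ.1 - ω.1 + 2 * k * π|) ^ 2 + (⨅ k : ℤ, |θ.2 - ω.2 + 2 * k * π|) ^ 2)

lemma inf_attained (x : ℝ) : ∃ k : ℤ, (⨅ k : ℤ, |x + 2 * k * π|) = |x + 2 * k * π| := by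
  have hpi := Real.pi_pos
  refine ⟨-round (x / (2 * π)), le_antisymm
    (ciInf_le ⟨0, by rintro _ ⟨k, rfl⟩; positivity⟩ (-round (x / (2 * π)))) (le_ciInf fun k => ?_)⟩
  have h := round_le (x / (2 * π)) (-k)
  have e : ∀ m : ℤ, |x + 2 * ((-m : ℤ) : ℝ) * π| = (2 * π) * |x / (2 * π) - m| := by
    intro m
    rw [← abs_of_pos (show 0 < 2 * π by positivity), ← abs_mul, abs_of_pos (show 0 < 2 * π by positivity)]
    congr 1
    push_cast
    field_simp
    ring
  have e2 := e (-k)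
  rw [neg_neg] at e2
  rw [e, e2]
  gcongr

lemma inf_le_abs (x : ℝ) (k : ℤ) : (⨅ k : ℤ, |x + 2 * k * π|) ≤ |x + 2 * k * π| :=
  ciInf_le ⟨0, by rintro _ ⟨k, rfl⟩; positivity⟩ k

lemma torus_le {u ω : ℝ × ℝ} (k l : ℤ) {T : ℝ} (hT : 0 ≤ T)
    (h : (u.1 - ω.1 + 2 * k * π) ^ 2 + (u.2 - ω.2 + 2 * l * π) ^ 2 ≤ T ^ 2) :
    torusDist u ω ≤ T := by
  unfold torusDist
  apply Real.sqrt_le_iff.2 ⟨hT, le_trans ?_ h⟩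
  rw [← sq_abs (u.1 - ω.1 + 2 * k * π), ← sq_abs (u.2 - ω.2 + 2 * l * π)]
  have h1 : 0 ≤ ⨅ k : ℤ, |u.1 - ω.1 + 2 * k * π| := Real.iInf_nonneg fun _ => abs_nonneg _
  have h2 : 0 ≤ ⨅ k : ℤ, |u.2 - ω.2 + 2 * k * π| := Real.iInf_nonneg fun _ => abs_nonneg _
  have := inf_le_abs (u.1 - ω.1) k
  have := inf_le_abs (u.2 - ω.2) l
  gcongr

lemma torus_rep {u ω : ℝ × ℝ} {T : ℝ} (h : torusDist u ω ≤ T) :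
    ∃ k l : ℤ, (u.1 - ω.1 + 2 * k * π) ^ 2 + (u.2 - ω.2 + 2 * l * π) ^ 2 ≤ T ^ 2 := by
  obtain ⟨k, hk⟩ := inf_attained (u.1 - ω.1)
  obtain ⟨l, hl⟩ := inf_attained (u.2 - ω.2)
  refine ⟨k, l, ?_⟩
  unfold torusDist at h
  rw [hk, hl, sq_abs, sq_abs] at h
  exact (Real.sqrt_le_iff.1 h).2

lemma per_shift {L : ℝ × ℝ → ℝ} (h1 : ∀ θ : ℝ × ℝ, L (θ.1 + 2 * π, θ.2) = L θ)
    (h2 : ∀ θ : ℝ × ℝ, L (θ.1, θ.2 + 2 * π) = L θ) (k l : ℤ) (θ : ℝ × ℝ) :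
    L (θ + (2 * k * π, 2 * l * π)) = L θ := by
  have p1 : ∀ y, Function.Periodic (fun x => L (x, y)) (2 * π) := fun y x => h1 (x, y)
  have p2 : ∀ x, Function.Periodic (fun y => L (x, y)) (2 * π) := fun x y => h2 (x, y)
  have a := (p1 (θ.2 + 2 * l * π)).int_mul k θ.1
  have b := (p2 θ.1).int_mul l θ.2
  have e : θ + (2 * k * π, 2 * l * π) = (θ.1 + k * (2 * π), θ.2 + 2 * l * π) := by
    ext <;> simp <;> ring
  rw [e, a, show θ.2 + 2 * (l : ℝ) * π = θ.2 + l * (2 * π) by ring]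
  exact b

lemma fderiv_shift {L : ℝ × ℝ → ℝ} (h1 : ∀ θ : ℝ × ℝ, L (θ.1 + 2 * π, θ.2) = L θ)
    (h2 : ∀ θ : ℝ × ℝ, L (θ.1, θ.2 + 2 * π) = L θ) (k l : ℤ) (θ : ℝ × ℝ) :
    fderiv ℝ L (θ + (2 * k * π, 2 * l * π)) = fderiv ℝ L θ := by
  rw [← fderiv_comp_add_right]
  congr 1
  funext x
  exact per_shift h1 h2 k l x

/-- local linearisation -/
lemma local_lin {L : ℝ × ℝ → ℝ} (hL : ContDiff ℝ 1 L) (ω : ℝ × ℝ) (h0 : L ω = 0)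
    {ε : ℝ} (hε : 0 < ε) : ∃ T > 0, ∀ θ : ℝ × ℝ, |θ.1 - ω.1| ≤ T → |θ.2 - ω.2| ≤ T →
      |L θ - (fderiv ℝ L ω (1, 0) * (θ.1 - ω.1) + fderiv ℝ L ω (0, 1) * (θ.2 - ω.2))|
        ≤ ε * (|θ.1 - ω.1| + |θ.2 - ω.2|) := by
  have hd : HasFDerivAt L (fderiv ℝ L ω) ω :=
    (hL.differentiable (by norm_num) ω).hasFDerivAt
  have h := hd.isLittleO.bound hε
  obtain ⟨T, hT, hb⟩ := Metric.eventually_nhds_iff.1 h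
  refine ⟨T / 2, by positivity, fun θ a b => ?_⟩
  have hdist : dist θ ω < T := by
    rw [Prod.dist_eq, Real.dist_eq, Real.dist_eq]
    exact lt_of_le_of_lt (max_le a b) (by linarith)
  have := hb hdist
  rw [h0, sub_zero] at this
  have e : θ - ω = (θ.1 - ω.1) • ((1 : ℝ), (0 : ℝ)) + (θ.2 - ω.2) • ((0 : ℝ), (1 : ℝ)) := by
    ext <;> simp
  have e2 : fderiv ℝ L ω (θ - ω) = fderiv ℝ L ω (1, 0) * (θ.1 - ω.1) + fderiv ℝ L ω (0, 1) * (θ.2 - ω.2) := by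
    rw [e, map_add, map_smul, map_smul, smul_eq_mul, smul_eq_mul]; ring
  rw [e2, Real.norm_eq_abs] at this
  refine this.trans ?_
  gcongr
  rw [Prod.norm_def]
  refine max_le ?_ ?_ <;> simp [Real.norm_eq_abs]

lemma local_der {L : ℝ × ℝ → ℝ} (hL : ContDiff ℝ 1 L) (ω v : ℝ × ℝ)
    {ε : ℝ} (hε : 0 < ε) : ∃ T > 0, ∀ θ : ℝ × ℝ, |θ.1 - ω.1| ≤ T → |θ.2 - ω.2| ≤ T →
      |fderiv ℝ L θ v - fderiv ℝ L ω v| ≤ ε := by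
  have hc : Continuous fun θ => fderiv ℝ L θ v :=
    (hL.continuous_fderiv (by norm_num)).clm_apply continuous_const
  obtain ⟨T, hT, hb⟩ := Metric.continuous_iff.1 hc ω ε hε
  refine ⟨T / 2, by positivity, fun θ a b => ?_⟩
  have hdist : dist θ ω < T := by
    rw [Prod.dist_eq, Real.dist_eq, Real.dist_eq]
    exact lt_of_le_of_lt (max_le a b) (by linarith)
  exact (hb θ hdist).le

lemma enorm2_le {a b δ : ℝ} (h : enorm2 (a, b) ≤ δ) : |a| ≤ δ ∧ |b| ≤ δ := by
  unfold enorm2 at h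
  exact ⟨(Real.abs_le_sqrt (by simp; positivity)).trans h,
    (Real.abs_le_sqrt (by simp; positivity)).trans h⟩

/-- The quadratic form estimate. -/
lemma quad_est {a b c d κ K ε δ T ν x y e1 e2 g1 g2 : ℝ} (ha : a < 0)
    (hκ : κ = -d - |b * (d / a) + c| / 2) (hκ0 : 0 < κ)
    (hK : |ν| ≤ K) (hε : 0 ≤ ε) (hδ : 0 ≤ δ) (hT : 0 ≤ T) (hν : |ν - d / a| ≤ ε)
    (hεκ : ε * (|a| + |b| + 2 * K + 2) ≤ κ / 2)
    (hxy : x ^ 2 + y ^ 2 ≤ T ^ 2)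
    (he1 : |e1| ≤ ε * (|x| + |y|)) (he2 : |e2| ≤ ε * (|x| + |y|))
    (hg1 : |g1| ≤ δ) (hg2 : |g2| ≤ δ) :
    x * ((a * x + b * y + (e1 + g1)) * ν) + y * (c * x + d * y + (e2 + g2))
      ≤ -(κ / 2) * (x ^ 2 + y ^ 2) + (K + 1) * δ * T := by
  have hK0 : 0 ≤ K := (abs_nonneg _).trans hK
  have hx : |x| ≤ T := abs_le_of_sq_le_sq (by nlinarith [sq_nonneg y]) hT
  have hy : |y| ≤ T := abs_le_of_sq_le_sq (by nlinarith [sq_nonneg x]) hT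
  have hda : a * (d / a) = d := mul_div_cancel₀ d ha.ne
  obtain ⟨N, hN⟩ : ∃ N, N = x ^ 2 + y ^ 2 := ⟨_, rfl⟩
  rw [← hN]
  have hN0 : 0 ≤ N := by rw [hN]; positivity
  have hxyN : |x * y| ≤ N / 2 := by
    rw [abs_mul, hN, ← sq_abs x, ← sq_abs y]; nlinarith [sq_nonneg (|x| - |y|)]
  have hxx : |x * x| ≤ N := by rw [abs_mul_self, hN]; nlinarith [sq_nonneg y]
  have t1 : (b * (d / a) + c) * (x * y) ≤ |b * (d / a) + c| * (N / 2) := by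
    refine (le_abs_self _).trans ?_
    rw [abs_mul]; gcongr
  have t2 : (ν - d / a) * (a * (x * x) + b * (x * y)) ≤ ε * ((|a| + |b|) * N) := by
    refine (le_abs_self _).trans ?_
    rw [abs_mul]; gcongr
    refine (abs_add_le _ _).trans ?_
    rw [abs_mul a, abs_mul b]
    have := mul_le_mul_of_nonneg_left hxx (abs_nonneg a)
    have := mul_le_mul_of_nonneg_left hxyN (abs_nonneg b)
    have := mul_nonneg (abs_nonneg b) hN0
    linarith
  have s1 : |x| * (|x| + |y|) ≤ 2 * N := by
    rw [hN, ← sq_abs x, ← sq_abs y]; nlinarith [sq_nonneg (|x| - |y|), sq_nonneg (|x|), sq_nonneg (|y|)]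
  have s2 : |y| * (|x| + |y|) ≤ 2 * N := by
    rw [hN, ← sq_abs x, ← sq_abs y]; nlinarith [sq_nonneg (|x| - |y|), sq_nonneg (|x|), sq_nonneg (|y|)]
  have t3 : ν * x * e1 ≤ K * ε * (2 * N) := by
    refine (le_abs_self _).trans ?_
    rw [abs_mul, abs_mul]
    calc |ν| * |x| * |e1| ≤ K * |x| * (ε * (|x| + |y|)) := by gcongr
      _ = K * ε * (|x| * (|x| + |y|)) := by ring
      _ ≤ _ := by gcongr
  have t4 : y * e2 ≤ ε * (2 * N) := by
    refine (le_abs_self _).trans ?_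
    rw [abs_mul]
    calc |y| * |e2| ≤ |y| * (ε * (|x| + |y|)) := by gcongr
      _ = ε * (|y| * (|x| + |y|)) := by ring
      _ ≤ _ := by gcongr
  have t5 : ν * x * g1 ≤ K * T * δ := by
    refine (le_abs_self _).trans ?_
    rw [abs_mul, abs_mul]; gcongr
  have t6 : y * g2 ≤ T * δ := by
    refine (le_abs_self _).trans ?_
    rw [abs_mul]; gcongr
  have key := mul_le_mul_of_nonneg_right hεκ hN0
  have expand : x * ((a * x + b * y + (e1 + g1)) * ν) + y * (c * x + d * y + (e2 + g2))
      = d * N + (b * (d / a) + c) * (x * y) + (ν - d / a) * (a * (x * x) + b * (x * y))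
        + ν * x * e1 + y * e2 + ν * x * g1 + y * g2 := by
    rw [hN]; linear_combination (x ^ 2) * hda
  rw [expand]
  have hd : d = -κ - |b * (d / a) + c| / 2 := by linarith
  have : d * N = -κ * N - |b * (d / a) + c| * (N / 2) := by
    linear_combination N * hd
  rw [this]
  linarith

lemma step_est {a b c d κ K ε δ T ν x y e1 e2 g1 g2 s C : ℝ} (ha : a < 0)
    (hκ : κ = -d - |b * (d / a) + c| / 2) (hκ0 : 0 < κ)
    (hK : |ν| ≤ K) (hε : 0 ≤ ε) (hδ : 0 ≤ δ) (hT : 0 < T) (hν : |ν - d / a| ≤ ε)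
    (hεκ : ε * (|a| + |b| + 2 * K + 2) ≤ κ / 2)
    (hxy : x ^ 2 + y ^ 2 ≤ T ^ 2)
    (he1 : |e1| ≤ ε * (|x| + |y|)) (he2 : |e2| ≤ ε * (|x| + |y|))
    (hg1 : |g1| ≤ δ) (hg2 : |g2| ≤ δ) (hε1 : ε ≤ 1) (hδ1 : δ ≤ 1) (hT1 : T ≤ 1)
    (hC : C = (K * (|a| + |b| + 3)) ^ 2 + (|c| + |d| + 3) ^ 2)
    (hs : 0 < s) (hs1 : s * κ ≤ 1) (hδ2 : 4 * (K + 1) * δ ≤ κ * T)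
    (hs2 : 2 * s * C ≤ κ * T ^ 2) :
    (x + (a * x + b * y + (e1 + g1)) * ν * s) ^ 2 + (y + (c * x + d * y + (e2 + g2)) * s) ^ 2
      ≤ T ^ 2 := by
  have q := quad_est ha hκ hκ0 hK hε hδ hT.le hν hεκ hxy he1 he2 hg1 hg2
  have hK0 : 0 ≤ K := (abs_nonneg _).trans hK
  have hx : |x| ≤ T := abs_le_of_sq_le_sq (by nlinarith [sq_nonneg y]) hT.le
  have hy : |y| ≤ T := abs_le_of_sq_le_sq (by nlinarith [sq_nonneg x]) hT.le
  have bd : ∀ a b e g : ℝ, |e| ≤ ε * (|x| + |y|) → |g| ≤ δ →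
      |a * x + b * y + (e + g)| ≤ |a| + |b| + 3 := by
    intro a b e g he hg
    have h1 : |a * x| ≤ |a| := by rw [abs_mul]; exact mul_le_of_le_one_right (abs_nonneg a) (hx.trans hT1)
    have h2 : |b * y| ≤ |b| := by rw [abs_mul]; exact mul_le_of_le_one_right (abs_nonneg b) (hy.trans hT1)
    have h3 : |e| ≤ 2 := he.trans ((mul_le_of_le_one_left (by positivity) hε1).trans (by linarith))
    calc _ ≤ |a * x| + |b * y| + (|e| + |g|) :=
          (abs_add_le _ _).trans (add_le_add (abs_add_le _ _) (abs_add_le _ _))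
      _ ≤ _ := by linarith
  have hP := bd a b _ _ he1 hg1
  have hQ := bd c d _ _ he2 hg2
  generalize a * x + b * y + (e1 + g1) = P at *
  generalize c * x + d * y + (e2 + g2) = Q at *
  have hPQ : (P * ν) ^ 2 + Q ^ 2 ≤ C := by
    rw [hC, ← sq_abs (P * ν), ← sq_abs Q, abs_mul, mul_comm (|P|)]
    gcongr
  have e : (x + P * ν * s) ^ 2 + (y + Q * s) ^ 2 = (x ^ 2 + y ^ 2) +
      2 * s * (x * (P * ν) + y * Q) + s * s * ((P * ν) ^ 2 + Q ^ 2) := by ring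
  rw [e]
  generalize x ^ 2 + y ^ 2 = N at *
  have i1 := mul_le_mul_of_nonneg_left q (show 0 ≤ 2 * s by positivity)
  have i2 := mul_le_mul_of_nonneg_left hPQ (show 0 ≤ s * s by positivity)
  have i3 := mul_le_mul_of_nonneg_left hxy (show 0 ≤ 1 - s * κ by linarith)
  have i4 := mul_le_mul_of_nonneg_left hδ2 (show 0 ≤ s * T by positivity)
  have i5 := mul_le_mul_of_nonneg_left hs2 hs.le
  linarith

lemma ratio_est {lam η A D r1 r2 : ℝ} (hr2 : 0 < r2) (hD : 0 < D)
    (h1 : lam - η ≤ r1 / r2) (h2 : r1 / r2 ≤ lam + η) (h : |A - lam * D| ≤ η * D) :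
    lam - η ≤ (r1 + A) / (r2 + D) ∧ (r1 + A) / (r2 + D) ≤ lam + η := by
  rw [le_div_iff₀ hr2] at h1
  rw [div_le_iff₀ hr2] at h2
  rw [le_div_iff₀ (by positivity), div_le_iff₀ (by positivity)]
  obtain ⟨h3, h4⟩ := abs_le.1 h
  constructor <;> nlinarith

set_option maxHeartbeats 8000000 in
theorem stmt9 (L₁ L₂ : ℝ × ℝ → ℝ)
    (hL₁ : ContDiff ℝ 1 L₁) (hL₂ : ContDiff ℝ 1 L₂)
    (hL₁per₁ : ∀ θ : ℝ × ℝ, L₁ (θ.1 + 2 * π, θ.2) = L₁ θ)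
    (hL₁per₂ : ∀ θ : ℝ × ℝ, L₁ (θ.1, θ.2 + 2 * π) = L₁ θ)
    (hL₂per₁ : ∀ θ : ℝ × ℝ, L₂ (θ.1 + 2 * π, θ.2) = L₂ θ)
    (hL₂per₂ : ∀ θ : ℝ × ℝ, L₂ (θ.1, θ.2 + 2 * π) = L₂ θ)
    (F₁ F₂ G₁ G₂ : ℝ × ℝ → ℝ × ℝ → ℝ)
    (hFcont : ContinuousOn (fun p : (ℝ × ℝ) × ℝ × ℝ => (F₁ p.1 p.2, F₂ p.1 p.2))
      {p : (ℝ × ℝ) × ℝ × ℝ | 0 < p.2.1 ∧ 0 < p.2.2})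
    (hGcont : ContinuousOn (fun p : (ℝ × ℝ) × ℝ × ℝ => (G₁ p.1 p.2, G₂ p.1 p.2))
      {p : (ℝ × ℝ) × ℝ × ℝ | 0 < p.2.1 ∧ 0 < p.2.2})
    (hFper : ∀ θ r : ℝ × ℝ, F₁ (θ.1 + 2 * π, θ.2) r = F₁ θ r ∧ F₁ (θ.1, θ.2 + 2 * π) r = F₁ θ r ∧
      F₂ (θ.1 + 2 * π, θ.2) r = F₂ θ r ∧ F₂ (θ.1, θ.2 + 2 * π) r = F₂ θ r)
    (hGper : ∀ θ r : ℝ × ℝ, G₁ (θ.1 + 2 * π, θ.2) r = G₁ θ r ∧ G₁ (θ.1, θ.2 + 2 * π) r = G₁ θ r ∧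
      G₂ (θ.1 + 2 * π, θ.2) r = G₂ θ r ∧ G₂ (θ.1, θ.2 + 2 * π) r = G₂ θ r)
    (hsmall : ∀ δ > (0 : ℝ), ∃ M > (0 : ℝ), ∀ θ r : ℝ × ℝ, 0 < r.1 → 0 < r.2 →
      M ≤ min r.1 r.2 → enorm2 (F₁ θ r, F₂ θ r) ≤ δ ∧ enorm2 (G₁ θ r, G₂ θ r) ≤ δ)
    (ω : ℝ × ℝ) (hω₁ : L₁ ω = 0) (hω₂ : L₂ ω = 0)
    -- the Jacobian matrix JL(ω) is a D⁺-matrix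
    (hD11 : fderiv ℝ L₁ ω (1, 0) < 0) (hD22 : fderiv ℝ L₂ ω (0, 1) < 0)
    (hDmix : |fderiv ℝ L₁ ω (0, 1) * fderiv ℝ L₂ ω (0, 1) +
        fderiv ℝ L₁ ω (1, 0) * fderiv ℝ L₂ ω (1, 0)| <
      2 * (fderiv ℝ L₁ ω (1, 0) * fderiv ℝ L₂ ω (0, 1))) :
    ∃ R > (0 : ℝ), ∃ Θ : ℝ, 0 < Θ ∧ Θ < π ∧ ∃ lam > (0 : ℝ), ∃ η : ℝ, 0 < η ∧ η < lam ∧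
      ∀ θ r : ℝ × ℝ, R ≤ r.1 → R ≤ r.2 →
        lam - η ≤ r.1 / r.2 → r.1 / r.2 ≤ lam + η → torusDist θ ω ≤ Θ →
        R ≤ r.1 - fderiv ℝ L₁ θ (1, 0) + F₁ θ r ∧
        R ≤ r.2 - fderiv ℝ L₂ θ (0, 1) + F₂ θ r ∧
        lam - η ≤ (r.1 - fderiv ℝ L₁ θ (1, 0) + F₁ θ r) /
          (r.2 - fderiv ℝ L₂ θ (0, 1) + F₂ θ r) ∧
        (r.1 - fderiv ℝ L₁ θ (1, 0) + F₁ θ r) /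
          (r.2 - fderiv ℝ L₂ θ (0, 1) + F₂ θ r) ≤ lam + η ∧
        torusDist (θ.1 + (L₁ θ + G₁ θ r) / r.1, θ.2 + (L₂ θ + G₂ θ r) / r.2) ω ≤ Θ := by
  have hpi := Real.pi_pos
  obtain ⟨a, ha_def⟩ : ∃ z, z = fderiv ℝ L₁ ω (1, 0) := ⟨_, rfl⟩
  obtain ⟨b, hb_def⟩ : ∃ z, z = fderiv ℝ L₁ ω (0, 1) := ⟨_, rfl⟩
  obtain ⟨c, hc_def⟩ : ∃ z, z = fderiv ℝ L₂ ω (1, 0) := ⟨_, rfl⟩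
  obtain ⟨d, hd_def⟩ : ∃ z, z = fderiv ℝ L₂ ω (0, 1) := ⟨_, rfl⟩
  rw [← ha_def] at hD11
  rw [← hd_def] at hD22
  rw [← ha_def, ← hb_def, ← hc_def, ← hd_def] at hDmix
  obtain ⟨κ, hκ⟩ : ∃ κ, κ = -d - |b * (d / a) + c| / 2 := ⟨_, rfl⟩
  have hκ0 : 0 < κ := by
    have e : b * d + a * c = a * (b * (d / a) + c) := by
      linear_combination (-b) * mul_div_cancel₀ d hD11.ne
    rw [e, abs_mul, abs_of_neg hD11] at hDmix
    rw [hκ]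
    by_contra hcon
    nlinarith [abs_nonneg (b * (d / a) + c)]
  obtain ⟨lam, hlam⟩ : ∃ lam, lam = a / d := ⟨_, rfl⟩
  have hlam0 : 0 < lam := hlam ▸ div_pos_of_neg_of_neg hD11 hD22
  have hlaminv : lam⁻¹ = d / a := by rw [hlam, inv_div]
  obtain ⟨K, hK⟩ : ∃ K, K = lam⁻¹ + 1 := ⟨_, rfl⟩
  have hK0 : 0 < K := by rw [hK]; positivity
  obtain ⟨C, hC⟩ : ∃ C, C = (K * (|a| + |b| + 3)) ^ 2 + (|c| + |d| + 3) ^ 2 := ⟨_, rfl⟩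
  have hC0 : 0 < C := by rw [hC]; positivity
  obtain ⟨ε, hε⟩ : ∃ ε, ε = min 1 (κ / 2 / (|a| + |b| + 2 * K + 2)) := ⟨_, rfl⟩
  have hε0 : 0 < ε := by rw [hε]; positivity
  have hε1 : ε ≤ 1 := by rw [hε]; exact min_le_left _ _
  have hεκ : ε * (|a| + |b| + 2 * K + 2) ≤ κ / 2 := by
    rw [← le_div_iff₀ (by positivity), hε]; exact min_le_right _ _
  -- choice of η
  obtain ⟨η0, hη0, hη⟩ := Metric.continuousAt_iff.1 (continuousAt_inv₀ hlam0.ne') ε hε0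
  obtain ⟨η, hηdef⟩ : ∃ η, η = min (η0 / 2) (lam / 2) := ⟨_, rfl⟩
  have hηpos : 0 < η := by rw [hηdef]; positivity
  have hη1 : η ≤ η0 / 2 := by rw [hηdef]; exact min_le_left _ _
  have hη2 : η ≤ lam / 2 := by rw [hηdef]; exact min_le_right _ _
  -- choice of ε₂
  obtain ⟨ε₂, hε₂⟩ : ∃ e, e = min (min (-a / 2) (-d / 2)) (η * (-d) / (2 * (1 + lam))) := ⟨_, rfl⟩
  have hna : 0 < -a := by linarith
  have hnd : 0 < -d := by linarith
  have hε₂0 : 0 < ε₂ := by rw [hε₂]; positivity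
  have hε₂a : ε₂ ≤ -a / 2 := by rw [hε₂]; exact (min_le_left _ _).trans (min_le_left _ _)
  have hε₂d : ε₂ ≤ -d / 2 := by rw [hε₂]; exact (min_le_left _ _).trans (min_le_right _ _)
  have hε₂η : ε₂ * (2 * (1 + lam)) ≤ η * (-d) := by
    rw [← le_div_iff₀ (by positivity), hε₂]; exact min_le_right _ _
  -- choice of Θ
  obtain ⟨T1, hT1, H1⟩ := local_lin hL₁ ω hω₁ hε0
  obtain ⟨T2, hT2, H2⟩ := local_lin hL₂ ω hω₂ hε0
  obtain ⟨T3, hT3, H3⟩ := local_der hL₁ ω (1, 0) (half_pos hε₂0)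
  obtain ⟨T4, hT4, H4⟩ := local_der hL₂ ω (0, 1) (half_pos hε₂0)
  obtain ⟨T, hT0, hTT1, hTT2, hTT3, hTT4, hTone⟩ :
      ∃ T > 0, T ≤ T1 ∧ T ≤ T2 ∧ T ≤ T3 ∧ T ≤ T4 ∧ T ≤ 1 :=
    ⟨min T1 (min T2 (min T3 (min T4 1))), by positivity, by simp, by simp, by simp, by simp, by simp⟩
  -- choice of δ
  obtain ⟨δ, hδ0, hδ1, hδ2, hδ3⟩ : ∃ δ > 0, δ ≤ 1 ∧ δ ≤ ε₂ / 2 ∧ δ ≤ κ * T / (4 * (K + 1)) :=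
    ⟨min 1 (min (ε₂ / 2) (κ * T / (4 * (K + 1)))), by positivity, by simp, by simp, by simp⟩
  have hδ3' : 4 * (K + 1) * δ ≤ κ * T := by
    rw [mul_comm, ← le_div_iff₀ (by positivity)]; exact hδ3
  obtain ⟨M, hM0, hM⟩ := hsmall δ hδ0
  obtain ⟨R, hR0, hRM, hRκ, hRC⟩ : ∃ R > 0, M ≤ R ∧ κ ≤ R ∧ 2 * C / (κ * T ^ 2) ≤ R :=
    ⟨max M (max κ (2 * C / (κ * T ^ 2))), by positivity, by simp, by simp, by simp⟩
  refine ⟨R, hR0, T, hT0, by linarith [Real.pi_gt_three], lam, hlam0, η, hηpos, by linarith, ?_⟩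
  intro θ r hr1 hr2 hl hu hθ
  have hr1p : 0 < r.1 := by linarith
  have hr2p : 0 < r.2 := by linarith
  obtain ⟨hFn, hGn⟩ := hM θ r hr1p hr2p (le_min (by linarith) (by linarith))
  obtain ⟨hF1, hF2⟩ := enorm2_le hFn
  obtain ⟨hG1, hG2⟩ := enorm2_le hGn
  obtain ⟨k, l, hkl⟩ := torus_rep hθ
  obtain ⟨x, hx⟩ : ∃ x, x = θ.1 - ω.1 + 2 * k * π := ⟨_, rfl⟩
  obtain ⟨y, hy⟩ : ∃ y, y = θ.2 - ω.2 + 2 * l * π := ⟨_, rfl⟩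
  rw [← hx, ← hy] at hkl
  have hxT : |x| ≤ T := abs_le_of_sq_le_sq (by nlinarith [sq_nonneg y]) hT0.le
  have hyT : |y| ≤ T := abs_le_of_sq_le_sq (by nlinarith [sq_nonneg x]) hT0.le
  have ex : (θ + (2 * k * π, 2 * l * π)).1 - ω.1 = x := by rw [hx]; simp; ring
  have ey : (θ + (2 * k * π, 2 * l * π)).2 - ω.2 = y := by rw [hy]; simp; ring
  have I1 := H1 (θ + (2 * k * π, 2 * l * π)) (by rw [ex]; linarith) (by rw [ey]; linarith)
  have I2 := H2 (θ + (2 * k * π, 2 * l * π)) (by rw [ex]; linarith) (by rw [ey]; linarith)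
  have I3 := H3 (θ + (2 * k * π, 2 * l * π)) (by rw [ex]; linarith) (by rw [ey]; linarith)
  have I4 := H4 (θ + (2 * k * π, 2 * l * π)) (by rw [ex]; linarith) (by rw [ey]; linarith)
  rw [per_shift hL₁per₁ hL₁per₂, ex, ey] at I1
  rw [per_shift hL₂per₁ hL₂per₂, ex, ey] at I2
  rw [fderiv_shift hL₁per₁ hL₁per₂] at I3
  rw [fderiv_shift hL₂per₁ hL₂per₂] at I4
  rw [← ha_def, ← hb_def] at I1
  rw [← hc_def, ← hd_def] at I2
  rw [← ha_def] at I3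
  rw [← hd_def] at I4
  obtain ⟨A, hA⟩ : ∃ A, A = - fderiv ℝ L₁ θ (1, 0) + F₁ θ r := ⟨_, rfl⟩
  obtain ⟨D, hD⟩ : ∃ D, D = - fderiv ℝ L₂ θ (0, 1) + F₂ θ r := ⟨_, rfl⟩
  have e1 : r.1 - fderiv ℝ L₁ θ (1, 0) + F₁ θ r = r.1 + A := by rw [hA]; ring
  have e2 : r.2 - fderiv ℝ L₂ θ (0, 1) + F₂ θ r = r.2 + D := by rw [hD]; ring
  rw [e1, e2]
  obtain ⟨f1, f1'⟩ := abs_le.1 hF1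
  obtain ⟨f2, f2'⟩ := abs_le.1 hF2
  obtain ⟨f3, f3'⟩ := abs_le.1 I3
  obtain ⟨f4, f4'⟩ := abs_le.1 I4
  have A1 : -ε₂ ≤ A + a := by linarith
  have A2 : A + a ≤ ε₂ := by linarith
  have D1 : -ε₂ ≤ D + d := by linarith
  have D2 : D + d ≤ ε₂ := by linarith
  have hlamd : lam * d = a := by rw [hlam]; exact div_mul_cancel₀ a hD22.ne
  have hrat : |A - lam * D| ≤ η * D := by
    have : A - lam * D = (A + a) - lam * (D + d) := by linear_combination hlamd
    rw [this]
    have j1 := mul_le_mul_of_nonneg_left D1 hlam0.le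
    have j2 := mul_le_mul_of_nonneg_left D2 hlam0.le
    have j3 : η * (-d / 2) ≤ η * D := mul_le_mul_of_nonneg_left (by linarith) hηpos.le
    rw [abs_le]
    constructor <;> linarith
  obtain ⟨c1, c2⟩ := ratio_est hr2p (show 0 < D by linarith) hl hu hrat
  refine ⟨by linarith, by linarith, c1, c2, ?_⟩
  apply torus_le k l hT0.le
  have hν : |r.2 / r.1 - d / a| ≤ ε := by
    have := @hη (r.1 / r.2) (by
      rw [Real.dist_eq]
      exact lt_of_le_of_lt (abs_le.2 ⟨by linarith, by linarith⟩ : _ ≤ η) (by linarith))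
    rw [Real.dist_eq, inv_div, hlaminv] at this
    exact this.le
  have hνK : |r.2 / r.1| ≤ K := by
    rw [abs_of_pos (by positivity), hK, hlaminv]
    linarith [(abs_le.1 hν).2]
  have fin := step_est (s := 1 / r.2) hD11 hκ hκ0 hνK hε0.le hδ0.le hT0 hν hεκ hkl I1 I2 hG1 hG2 hε1 hδ1 hTone hC
    (by positivity) (by rw [one_div_mul_eq_div, div_le_one hr2p]; linarith) hδ3'
    (by
      rw [mul_one_div, div_mul_eq_mul_div, div_le_iff₀ hr2p]
      have := (div_le_iff₀ (by positivity)).1 (hRC.trans hr2)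
      linarith)
  convert fin using 3
  · rw [hx]; field_simp; ring
  · rw [hy]; field_simp; ring
end
end
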